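/- Let 0 < ε < 1, let b = 1 + √2, and let k be an integer with k ≥ 1/(bε³). Let G be a graph and let e₁, …, e_m be any ordering of the edges of G. Let M be the greedy maximal matching obtained by processing e₁,…,e_m in order and adding each edge whose both endpoints are currently unmatched. Let H = G[V(M), V\V(M)] be the bipartite subgraph of G consisting of all edges with exactly one endpoint in V(M), and let B be the edge set obtained by processing the edges of H in the order they appear in e₁,…,e_m and adding an edge (u,v) with u ∈ V(M), v ∉ V(M) if and only if currently deg_B(u) < k and deg_B(v) < ⌈kb⌉. Then the subgraph of G with edge set M ∪ B contains a matching of size at least (1−ε)³ · (2−√2) · μ(G). -/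

import Mathlib

/-- `N` is a matching of the simple graph `G`: a set of edges of `G` that are
pairwise vertex-disjoint. -/
def IsMatching {V : Type*} (G : SimpleGraph V) (N : Finset (Sym2 V)) : Prop :=
  (∀ e ∈ N, e ∈ G.edgeSet) ∧
    ∀ e ∈ N, ∀ f ∈ N, e ≠ f → ∀ v : V, v ∈ e → v ∉ f

/-- `v` is covered by the matching `M`, i.e. `v ∈ V(M)`. -/
def Covered {V : Type*} (M : Finset (Sym2 V)) (v : V) : Prop := ∃ e ∈ M, v ∈ e

instance {V : Type*} [DecidableEq V] (M : Finset (Sym2 V)) : DecidablePred (Covered M) :=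
  fun v => decidable_of_iff (∃ e ∈ M, v ∈ e) Iff.rfl

/-- `degE B w` is the number of edges of `B` incident to the vertex `w`. -/
def degE {V : Type*} [DecidableEq V] (B : Finset (Sym2 V)) (w : V) : ℕ :=
  (B.filter fun e => w ∈ e).card

/-- One step of the greedy maximal matching: the arriving edge is added exactly when
both of its endpoints are currently uncovered. -/
def gmmStep {V : Type*} [Fintype V] [DecidableEq V] (M : Finset (Sym2 V)) (e : Sym2 V) :
    Finset (Sym2 V) :=
  if ∀ v ∈ e, ¬ Covered M v then insert e M else M

/-- The greedy maximal matching obtained by processing the listed edges in order. -/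
def greedyMatching {V : Type*} [Fintype V] [DecidableEq V] (l : List (Sym2 V)) :
    Finset (Sym2 V) :=
  l.foldl gmmStep ∅

/-- One step of the greedy `b`-matching construction in the bipartite graph
`H = G[V(M), V∖V(M)]`, with capacity `k` on vertices covered by `M` and `K` on uncovered
vertices: the arriving edge is added iff it has exactly one endpoint covered by `M`,
it is not already present, and both endpoints have remaining capacity. -/
def bStep {V : Type*} [Fintype V] [DecidableEq V] (M : Finset (Sym2 V)) (k K : ℕ)
    (B : Finset (Sym2 V)) (e : Sym2 V) : Finset (Sym2 V) :=
  if (∃ v ∈ e, Covered M v) ∧ (∃ v ∈ e, ¬ Covered M v) ∧ e ∉ B ∧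
      (∀ u ∈ e, Covered M u → degE B u < k) ∧ (∀ v ∈ e, ¬ Covered M v → degE B v < K)
    then insert e B else B

/-- The greedy `b`-matching obtained by processing, in the given order, the edges of the
bipartite graph between vertices covered and uncovered by `M` (edges that are not in this
bipartite graph are skipped by `bStep`). -/
def greedyB {V : Type*} [Fintype V] [DecidableEq V] (M : Finset (Sym2 V)) (k K : ℕ)
    (l : List (Sym2 V)) : Finset (Sym2 V) :=
  l.foldl (bStep M k K) ∅


theorem gm_spec {V : Type*} [Fintype V] [DecidableEq V] (l : List (Sym2 V)) :
    (∀ e ∈ greedyMatching l, e ∈ l) ∧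
    (∀ e ∈ greedyMatching l, ∀ f ∈ greedyMatching l, e ≠ f → ∀ v : V, v ∈ e → v ∉ f) ∧
    (∀ e ∈ l, ∃ v ∈ e, Covered (greedyMatching l) v) := by
  induction l using List.reverseRecOn with
  | nil => simp [greedyMatching]
  | append_singleton l e ih =>
    obtain ⟨h1, h2, h3⟩ := ih
    have hE : greedyMatching (l ++ [e]) = gmmStep (greedyMatching l) e := by
      simp [greedyMatching, List.foldl_append]
    rw [hE]
    unfold gmmStep
    split_ifs with hc
    · refine ⟨?_, ?_, ?_⟩
      · intro f hf
        rw [Finset.mem_insert] at hf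
        rcases hf with rfl | hf
        · simp
        · simp [h1 f hf]
      · intro f hf g hg hne v hvf hvg
        rw [Finset.mem_insert] at hf hg
        rcases hf with rfl | hf <;> rcases hg with rfl | hg
        · exact hne rfl
        · exact hc v hvf ⟨g, hg, hvg⟩
        · exact hc v hvg ⟨f, hf, hvf⟩
        · exact h2 f hf g hg hne v hvf hvg
      · intro f hf
        rw [List.mem_append, List.mem_singleton] at hf
        rcases hf with hf | rfl
        · obtain ⟨v, hv, g, hg, hvg⟩ := h3 f hf
          exact ⟨v, hv, g, Finset.mem_insert_of_mem hg, hvg⟩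
        · induction f using Sym2.ind with
          | _ a b => exact ⟨a, by simp, s(a, b), by simp, by simp⟩
    · refine ⟨fun f hf => by simp [h1 f hf], h2, ?_⟩
      intro f hf
      rw [List.mem_append, List.mem_singleton] at hf
      rcases hf with hf | rfl
      · exact h3 f hf
      · push Not at hc
        exact hc

theorem degE_insert_of_mem {V : Type*} [DecidableEq V] {B : Finset (Sym2 V)} {e : Sym2 V}
    {w : V} (he : e ∉ B) (hw : w ∈ e) : degE (insert e B) w = degE B w + 1 := by
  unfold degE
  rw [Finset.filter_insert, if_pos hw, Finset.card_insert_of_notMem (by simp [he])]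

theorem degE_insert_of_notMem {V : Type*} [DecidableEq V] {B : Finset (Sym2 V)} {e : Sym2 V}
    {w : V} (hw : w ∉ e) : degE (insert e B) w = degE B w := by
  unfold degE
  rw [Finset.filter_insert, if_neg hw]

theorem degE_le_insert {V : Type*} [DecidableEq V] (B : Finset (Sym2 V)) (e : Sym2 V)
    (w : V) : degE B w ≤ degE (insert e B) w := by
  unfold degE
  exact Finset.card_le_card (Finset.filter_subset_filter _ (Finset.subset_insert _ _))

theorem gb_spec {V : Type*} [Fintype V] [DecidableEq V] (M : Finset (Sym2 V)) (k K : ℕ)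
    (l : List (Sym2 V)) :
    (∀ e ∈ greedyB M k K l, e ∈ l ∧ (∃ v ∈ e, Covered M v) ∧ (∃ v ∈ e, ¬ Covered M v)) ∧
    (∀ u, Covered M u → degE (greedyB M k K l) u ≤ k) ∧
    (∀ u, ¬ Covered M u → degE (greedyB M k K l) u ≤ K) ∧
    (∀ e ∈ l, (∃ v ∈ e, Covered M v) → (∃ v ∈ e, ¬ Covered M v) → e ∉ greedyB M k K l →
      (∃ u ∈ e, Covered M u ∧ k ≤ degE (greedyB M k K l) u) ∨
      (∃ u ∈ e, ¬ Covered M u ∧ K ≤ degE (greedyB M k K l) u)) := by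
  induction l using List.reverseRecOn with
  | nil => simp [greedyB, degE]
  | append_singleton l e ih =>
    obtain ⟨h1, h2, h3, h4⟩ := ih
    have hE : greedyB M k K (l ++ [e]) = bStep M k K (greedyB M k K l) e := by
      simp [greedyB, List.foldl_append]
    rw [hE]
    unfold bStep
    split_ifs with hc
    · obtain ⟨c1, c2, c3, c4, c5⟩ := hc
      refine ⟨?_, ?_, ?_, ?_⟩
      · intro f hf
        rw [Finset.mem_insert] at hf
        rcases hf with rfl | hf
        · exact ⟨by simp, c1, c2⟩
        · exact ⟨by simp [(h1 f hf).1], (h1 f hf).2⟩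
      · intro u hu
        by_cases hue : u ∈ e
        · rw [degE_insert_of_mem c3 hue]; exact c4 u hue hu
        · rw [degE_insert_of_notMem hue]; exact h2 u hu
      · intro u hu
        by_cases hue : u ∈ e
        · rw [degE_insert_of_mem c3 hue]; exact c5 u hue hu
        · rw [degE_insert_of_notMem hue]; exact h3 u hu
      · intro f hf hf1 hf2 hf3
        rw [Finset.mem_insert, not_or] at hf3
        rw [List.mem_append, List.mem_singleton] at hf
        rcases hf with hf | rfl
        · rcases h4 f hf hf1 hf2 hf3.2 with ⟨u, hu, hu1, hu2⟩ | ⟨u, hu, hu1, hu2⟩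
          · exact Or.inl ⟨u, hu, hu1, hu2.trans (degE_le_insert _ _ _)⟩
          · exact Or.inr ⟨u, hu, hu1, hu2.trans (degE_le_insert _ _ _)⟩
        · exact absurd rfl hf3.1
    · refine ⟨fun f hf => ⟨by simp [(h1 f hf).1], (h1 f hf).2⟩, h2, h3, ?_⟩
      intro f hf hf1 hf2 hf3
      rw [List.mem_append, List.mem_singleton] at hf
      rcases hf with hf | rfl
      · exact h4 f hf hf1 hf2 hf3
      · by_contra hcon
        push Not at hcon
        exact hc ⟨hf1, hf2, hf3, hcon.1, hcon.2⟩

theorem sum_supp_ncard {X : Type*} [Finite X] (H : SimpleGraph X)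
    [Fintype H.ConnectedComponent] :
    ∑ c : H.ConnectedComponent, c.supp.ncard = Nat.card X := by
  classical
  cases nonempty_fintype X
  rw [Nat.card_eq_fintype_card, ← Finset.card_univ,
    Finset.card_eq_sum_card_fiberwise (f := H.connectedComponentMk) (t := Finset.univ)
      (fun _ _ => by simp)]
  refine Finset.sum_congr rfl fun c _ => ?_
  rw [← Set.ncard_coe_finset]
  congr 1
  ext x
  simp

theorem oddComponents_ncard_eq {X : Type*} [Finite X] (H : SimpleGraph X)
    [Fintype H.ConnectedComponent] :
    H.oddComponents.ncard = ∑ c : H.ConnectedComponent, c.supp.ncard % 2 := by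
  classical
  have h1 : H.oddComponents =
      ((Finset.univ.filter fun c : H.ConnectedComponent => Odd c.supp.ncard :
        Finset H.ConnectedComponent) : Set H.ConnectedComponent) := by
    ext c; simp
  rw [h1, Set.ncard_coe_finset, Finset.card_filter]
  refine Finset.sum_congr rfl fun c _ => ?_
  split_ifs with h
  · exact (Nat.odd_iff.1 h).symm
  · exact (Nat.even_iff.1 (Nat.not_odd_iff_even.1 h)).symm

/-- The graph `G` with `m` additional universal vertices. -/
def addUniv {V : Type*} (G : SimpleGraph V) (m : ℕ) : SimpleGraph (V ⊕ Fin m) where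
  Adj x y := x ≠ y ∧ ∀ a b, x = Sum.inl a → y = Sum.inl b → G.Adj a b
  symm := ⟨fun _ _ h => ⟨h.1.symm, fun a b ha hb => (h.2 b a hb ha).symm⟩⟩
  loopless := ⟨fun _ h => h.1 rfl⟩

theorem matching_of_perfect {V : Type*} [Fintype V] [DecidableEq V] (G : SimpleGraph V) (m : ℕ)
    (P : (addUniv G m).Subgraph) (hP : P.IsPerfectMatching) :
    ∃ N : Finset (Sym2 V), IsMatching G N ∧ Fintype.card V ≤ m + 2 * N.card := by
  classical
  rw [SimpleGraph.Subgraph.isPerfectMatching_iff] at hP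
  let N : Finset (Sym2 V) := Finset.univ.filter fun e => e.map Sum.inl ∈ P.edgeSet
  have hN : ∀ a b, s(a, b) ∈ N ↔ P.Adj (Sum.inl a) (Sum.inl b) := by
    intro a b; simp [N]
  refine ⟨N, ⟨?_, ?_⟩, ?_⟩
  · intro e
    induction e using Sym2.ind with
    | _ a b =>
      intro h
      rw [hN] at h
      exact (P.adj_sub h).2 a b rfl rfl
  · intro e he f hf hne v hve hvf
    obtain ⟨a, rfl⟩ := hve
    obtain ⟨c, rfl⟩ := hvf
    rw [hN] at he hf
    have := (hP (Sum.inl v)).unique he hf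
    rw [Sum.inl_injective this] at hne
    exact hne rfl
  · choose p hp hp' using hP
    let A : Finset V := Finset.univ.filter fun v => (p (Sum.inl v)).isLeft
    let A' : Finset V := Finset.univ.filter fun v => ¬ (p (Sum.inl v)).isLeft
    have hA : A.card ≤ 2 * N.card := by
      have : A ⊆ N.biUnion fun e => e.toFinset := by
        intro v hv
        simp only [A, Finset.mem_filter, Finset.mem_univ, true_and, Sum.isLeft_iff] at hv
        obtain ⟨w, hw⟩ := hv
        rw [Finset.mem_biUnion]
        refine ⟨s(v, w), ?_, by simp⟩
        rw [hN, ← hw]; exact hp _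
      refine (Finset.card_le_card this).trans ?_
      rw [mul_comm]
      refine Finset.card_biUnion_le_card_mul _ _ _ fun e _ => ?_
      rw [Sym2.card_toFinset]; split_ifs <;> omega
    have hA' : A'.card ≤ m := by
      have h1 : A'.card ≤ (Finset.univ.image (Sum.inr : Fin m → V ⊕ Fin m)).card := by
        refine Finset.card_le_card_of_injOn (fun v => p (Sum.inl v)) ?_ ?_
        · intro v hv
          simp only [A', Finset.coe_filter, Finset.mem_univ, true_and, Set.mem_ofPred_eq,
            Sum.not_isLeft, Sum.isRight_iff] at hv
          obtain ⟨w, hw⟩ := hv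
          simp [hw]
        · intro v _ w _ hvw
          have e1 := hp (Sum.inl v)
          have e2 := hp (Sum.inl w)
          simp only at hvw
          rw [← hvw] at e2
          have := (hp' _ _ e1.symm).trans (hp' _ _ e2.symm).symm
          exact Sum.inl_injective this
      refine h1.trans (Finset.card_image_le.trans (by simp))
    have : A.card + A'.card = Fintype.card V := by
      exact Finset.card_filter_add_card_filter_not
        (s := (Finset.univ : Finset V)) (fun v => (p (Sum.inl v)).isLeft)
    omega

theorem tutteBerge {V : Type*} [Fintype V] [DecidableEq V] (G : SimpleGraph V) :
    ∃ N : Finset (Sym2 V), IsMatching G N ∧ ∃ (U : Finset V) (F : Finset (Finset V)),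
      (∀ a b, G.Adj a b → a ∈ U ∨ b ∈ U ∨ ∃ C ∈ F, a ∈ C ∧ b ∈ C) ∧
      U.card + ∑ C ∈ F, C.card / 2 ≤ N.card := by
  classical
  obtain ⟨N, hN, hmax⟩ : ∃ N : Finset (Sym2 V), IsMatching G N ∧
      ∀ N', IsMatching G N' → N'.card ≤ N.card := by
    obtain ⟨N, h1, h2⟩ := Finset.exists_max_image
      (Finset.univ.filter fun N : Finset (Sym2 V) => IsMatching G N) Finset.card
      ⟨∅, Finset.mem_filter.2 ⟨Finset.mem_univ _, by simp [IsMatching]⟩⟩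
    exact ⟨N, by simpa using h1, fun N' h => h2 N' (by simpa using h)⟩
  refine ⟨N, hN, ?_⟩
  by_cases hd : Fintype.card V ≤ 2 * N.card + 1
  · refine ⟨∅, {Finset.univ}, ?_, ?_⟩
    · intro a b _; right; right; exact ⟨_, Finset.mem_singleton_self _, by simp, by simp⟩
    · simp; omega
  obtain ⟨m, hm⟩ : ∃ m, Fintype.card V = 2 * N.card + 2 + m := ⟨_, (by omega : _ =
    2 * N.card + 2 + (Fintype.card V - (2 * N.card + 2)))⟩
  have hno : ¬ ∃ P : (addUniv G m).Subgraph, P.IsPerfectMatching := by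
    rintro ⟨P, hP⟩
    obtain ⟨N', h1, h2⟩ := matching_of_perfect G m P hP
    have := hmax N' h1
    omega
  rw [SimpleGraph.tutte] at hno
  push Not at hno
  obtain ⟨W, hW⟩ := hno
  unfold SimpleGraph.IsTutteViolator at hW
  set D := (⊤ : (addUniv G m).Subgraph).deleteVerts W with hD
  have hverts : ∀ x, x ∈ D.verts ↔ x ∉ W := by intro x; simp [hD]
  have hcardD : Nat.card D.verts + W.ncard = Fintype.card V + m := by
    have h1 : D.verts = Wᶜ := by ext x; simp [hverts]
    have h2 := Set.ncard_add_ncard_compl W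
    rw [Nat.card_eq_fintype_card, Fintype.card_sum, Fintype.card_fin] at h2
    rw [h1, Nat.card_coe_set_eq]
    omega
  have hadj : ∀ x y : D.verts, (addUniv G m).Adj x y → D.coe.Adj x y := by
    intro x y h
    have hx := (hverts _).1 x.2
    have hy := (hverts _).1 y.2
    rw [SimpleGraph.Subgraph.coe_adj]
    refine SimpleGraph.Subgraph.deleteVerts_adj.2 ?_
    simp [hx, hy, h]
  have hpar := SimpleGraph.odd_ncard_oddComponents (G := D.coe)
  have hodd2 : W.ncard + 2 ≤ D.coe.oddComponents.ncard := by
    rw [Nat.odd_iff, Nat.odd_iff] at hpar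
    omega
  have huniv : ∀ i : Fin m, Sum.inr i ∈ W := by
    intro i
    by_contra hi
    have hi' := (hverts _).2 hi
    have : D.coe.oddComponents.Subsingleton := by
      have key : ∀ c : D.coe.ConnectedComponent,
          c = D.coe.connectedComponentMk ⟨Sum.inr i, hi'⟩ := by
        intro c
        induction c using SimpleGraph.ConnectedComponent.ind with
        | _ x =>
          rw [SimpleGraph.ConnectedComponent.eq]
          by_cases hx : x = ⟨Sum.inr i, hi'⟩
          · rw [hx]
          · refine (hadj _ _ ⟨fun h => hx (Subtype.ext h), ?_⟩).reachable
            intro a b _ h; simp at h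
      intro c _ c' _
      rw [key c, key c']
    have := Set.ncard_le_one_iff_subsingleton.2 this
    omega
  let U : Finset V := Finset.univ.filter fun v => Sum.inl v ∈ W
  have hU : U.card + m ≤ W.ncard := by
    have h1 : (((U.image Sum.inl) ∪ (Finset.univ.image Sum.inr) : Finset (V ⊕ Fin m)) :
        Set (V ⊕ Fin m)) ⊆ W := by
      intro x hx
      simp only [Finset.coe_union, Finset.coe_image, Set.mem_union, Set.mem_image] at hx
      rcases hx with ⟨v, hv, rfl⟩ | ⟨i, _, rfl⟩
      · simpa [U] using hv
      · exact huniv i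
    have h2 := Set.ncard_le_ncard h1 (Set.toFinite _)
    rw [Set.ncard_coe_finset, Finset.card_union_of_disjoint,
      Finset.card_image_of_injective _ Sum.inl_injective,
      Finset.card_image_of_injective _ Sum.inr_injective] at h2
    · simpa using h2
    · rw [Finset.disjoint_left]; simp
  have : Fintype D.coe.ConnectedComponent := Fintype.ofFinite _
  let Cf : D.coe.ConnectedComponent → Finset V := fun c =>
    Finset.univ.filter fun v => ∃ h : Sum.inl v ∈ D.verts,
      D.coe.connectedComponentMk ⟨Sum.inl v, h⟩ = c
  have hCf : ∀ c, (Cf c).card ≤ c.supp.ncard := by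
    intro c
    have h1 : ((Cf c).image (Sum.inl : V → V ⊕ Fin m) : Set (V ⊕ Fin m)) ⊆
        Subtype.val '' c.supp := by
      intro x hx
      simp only [Finset.coe_image, Set.mem_image, Cf, Finset.coe_filter, Finset.mem_univ,
        true_and, Set.mem_ofPred_eq] at hx
      obtain ⟨v, ⟨h, hc⟩, rfl⟩ := hx
      exact ⟨⟨_, h⟩, hc, rfl⟩
    have h2 := Set.ncard_le_ncard h1 (Set.toFinite _)
    rw [Set.ncard_coe_finset, Finset.card_image_of_injective _ Sum.inl_injective,
      Set.ncard_image_of_injective _ Subtype.val_injective] at h2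
    exact h2
  refine ⟨U, Finset.univ.image Cf, ?_, ?_⟩
  · intro a b hab
    by_cases ha : Sum.inl a ∈ W
    · left; simpa [U] using ha
    by_cases hb : Sum.inl b ∈ W
    · right; left; simpa [U] using hb
    right; right
    have ha' := (hverts _).2 ha
    have hb' := (hverts _).2 hb
    refine ⟨Cf (D.coe.connectedComponentMk ⟨Sum.inl a, ha'⟩), by simp, ?_, ?_⟩
    · simp only [Cf, Finset.mem_filter, Finset.mem_univ, true_and]
      exact ⟨ha', trivial⟩
    · simp only [Cf, Finset.mem_filter, Finset.mem_univ, true_and]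
      refine ⟨hb', ?_⟩
      rw [SimpleGraph.ConnectedComponent.eq]
      refine (hadj _ _ ⟨?_, ?_⟩).reachable
      · simpa using hab.ne'
      · intro x y hx hy
        rw [← Sum.inl_injective hx, ← Sum.inl_injective hy]; exact hab.symm
  · have e1 : ∑ C ∈ Finset.univ.image Cf, C.card / 2 ≤ ∑ c, (Cf c).card / 2 :=
      Finset.sum_image_le_of_nonneg (fun _ _ => Nat.zero_le _)
    have e2 : ∑ c, (Cf c).card / 2 ≤ ∑ c : D.coe.ConnectedComponent, c.supp.ncard / 2 :=
      Finset.sum_le_sum fun c _ => Nat.div_le_div_right (hCf c)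
    have e3 : ∑ c : D.coe.ConnectedComponent, c.supp.ncard = Nat.card D.verts :=
      sum_supp_ncard D.coe
    have e4 : D.coe.oddComponents.ncard =
        ∑ c : D.coe.ConnectedComponent, c.supp.ncard % 2 :=
      oddComponents_ncard_eq D.coe
    have e5 : ∑ c : D.coe.ConnectedComponent, c.supp.ncard =
        2 * ∑ c : D.coe.ConnectedComponent, c.supp.ncard / 2 +
          ∑ c : D.coe.ConnectedComponent, c.supp.ncard % 2 := by
      rw [Finset.mul_sum, ← Finset.sum_add_distrib]
      exact Finset.sum_congr rfl fun c _ => by omega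
    omega

/-- Incidence indicator. -/
def inc {V : Type*} [DecidableEq V] (v : V) (e : Sym2 V) : ℝ := if v ∈ e then 1 else 0

/-- Indicator that the edge lies inside `C`. -/
def ins {V : Type*} [DecidableEq V] (C : Finset V) (e : Sym2 V) : ℝ :=
  if e ∈ C.sym2 then 1 else 0

theorem inc_nonneg {V : Type*} [DecidableEq V] (v : V) (e : Sym2 V) : 0 ≤ inc v e := by
  unfold inc; split_ifs <;> norm_num

theorem ins_nonneg {V : Type*} [DecidableEq V] (C : Finset V) (e : Sym2 V) : 0 ≤ ins C e := by
  unfold ins; split_ifs <;> norm_num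

theorem inc_sum {V : Type*} [Fintype V] [DecidableEq V] (g : V → ℝ) {a b : V} (hab : a ≠ b) :
    ∑ v, g v * inc v s(a, b) = g a + g b := by
  have h : ∀ v, g v * inc v s(a, b) = (if v = a then g v else 0) + (if v = b then g v else 0) := by
    intro v
    unfold inc
    by_cases h1 : v = a
    · subst h1; simp [hab]
    · simp [h1]
  simp_rw [h]
  rw [Finset.sum_add_distrib]
  simp

theorem matching_at_le {V : Type*} [DecidableEq V] (A : Finset (Sym2 V))
    (hA : ∀ e ∈ A, ∀ f ∈ A, e ≠ f → ∀ v : V, v ∈ e → v ∉ f) (h : Sym2 V → ℝ) (v : V) (c : ℝ)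
    (hc : 0 ≤ c) (hh : ∀ e ∈ A, v ∈ e → h e ≤ c) : ∑ e ∈ A, h e * inc v e ≤ c := by
  by_cases hex : ∃ e ∈ A, v ∈ e
  · obtain ⟨e, he, hv⟩ := hex
    rw [Finset.sum_eq_single_of_mem e he]
    · simpa [inc, hv] using hh e he hv
    · intro f hf hne
      have := hA e he f hf hne.symm v hv
      simp [inc, this]
  · push Not at hex
    rw [Finset.sum_eq_zero]
    · exact hc
    · intro e he
      simp [inc, hex e he]

theorem matching_sum_le {V : Type*} [Fintype V] [DecidableEq V] (A : Finset (Sym2 V))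
    (hA : ∀ e ∈ A, ∀ f ∈ A, e ≠ f → ∀ v : V, v ∈ e → v ∉ f) (g : V → ℝ)
    (hg : ∀ v, 0 ≤ g v) : ∑ e ∈ A, ∑ v, g v * inc v e ≤ ∑ v, g v := by
  rw [Finset.sum_comm]
  exact Finset.sum_le_sum fun v _ => matching_at_le A hA (fun _ => g v) v _ (hg v)
    fun _ _ _ => le_rfl

/-- A fractional matching inside `C` has value at most `|C| / 2`. -/
theorem half_bound {V : Type*} [Fintype V] [DecidableEq V] (E : Finset (Sym2 V))
    (hE : ∀ e ∈ E, ¬ e.IsDiag) (w : Sym2 V → ℝ) (hw : ∀ e ∈ E, 0 ≤ w e)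
    (hdeg : ∀ v, ∑ e ∈ E, w e * inc v e ≤ 1) (C : Finset V) :
    2 * ∑ e ∈ E, w e * ins C e ≤ C.card := by
  have h1 : ∑ v ∈ C, ∑ e ∈ E, w e * inc v e ≤ ∑ v ∈ C, (1 : ℝ) :=
    Finset.sum_le_sum fun v _ => hdeg v
  rw [Finset.sum_comm] at h1
  rw [Finset.mul_sum]
  refine le_trans (Finset.sum_le_sum ?_) (h1.trans (by simp))
  intro e he
  have hd := hE e he
  have hwe := hw e he
  rw [← Finset.mul_sum]
  have : 2 * ins C e ≤ ∑ v ∈ C, inc v e := by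
    by_cases hC : e ∈ C.sym2
    · induction e using Sym2.ind with
      | _ a b =>
        have hab : a ≠ b := by simpa using hd
        have h2 : ∑ v ∈ ({a, b} : Finset V), inc v s(a, b) ≤ ∑ v ∈ C, inc v s(a, b) := by
          refine Finset.sum_le_sum_of_subset_of_nonneg ?_ fun _ _ _ => inc_nonneg _ _
          intro v hv
          exact Finset.mem_sym2_iff.1 hC v (by simpa using hv)
        rw [Finset.sum_pair hab] at h2
        unfold ins
        rw [if_pos hC]
        simp only [inc, Sym2.mem_mk_left, Sym2.mem_mk_right, if_true] at h2 ⊢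
        linarith
    · unfold ins
      rw [if_neg hC]
      simpa using Finset.sum_nonneg fun v _ => inc_nonneg v e
  nlinarith

theorem matching_in_card {V : Type*} [Fintype V] [DecidableEq V] (A : Finset (Sym2 V))
    (hd : ∀ e ∈ A, ¬ e.IsDiag)
    (hA : ∀ e ∈ A, ∀ f ∈ A, e ≠ f → ∀ v : V, v ∈ e → v ∉ f) (C : Finset V) :
    ∑ e ∈ A, ins C e ≤ ((C.card / 2 : ℕ) : ℝ) := by
  have h := half_bound A hd (fun _ => 1) (fun _ _ => zero_le_one)
    (fun v => matching_at_le A hA (fun _ => 1) v 1 zero_le_one fun _ _ _ => le_rfl) C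
  have h2 : ∑ e ∈ A, ins C e = ((A.filter fun e => e ∈ C.sym2).card : ℝ) := by
    rw [Finset.card_filter]; push_cast; rfl
  simp only [one_mul] at h
  rw [h2] at h ⊢
  have h3 : 2 * (A.filter fun e => e ∈ C.sym2).card ≤ C.card := by exact_mod_cast h
  exact_mod_cast (by omega : (A.filter fun e => e ∈ C.sym2).card ≤ C.card / 2)

theorem edges_in_card {V : Type*} [Fintype V] [DecidableEq V] (A : Finset (Sym2 V))
    (hd : ∀ e ∈ A, ¬ e.IsDiag) (C : Finset V) :
    ∑ e ∈ A, ins C e ≤ (C.card : ℝ) * (C.card - 1) / 2 := by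
  have h2 : ∑ e ∈ A, ins C e = ((A.filter fun e => e ∈ C.sym2).card : ℝ) := by
    rw [Finset.card_filter]; push_cast; rfl
  rw [h2]
  have h3 : (A.filter fun e => e ∈ C.sym2) ⊆ C.offDiag.image (Function.uncurry Sym2.mk) := by
    intro e he
    rw [Finset.mem_filter] at he
    obtain ⟨he, hC⟩ := he
    rw [Finset.mem_sym2_iff] at hC
    have := hd e he
    induction e using Sym2.ind with
    | _ a b =>
      rw [Finset.mem_image]
      refine ⟨(a, b), ?_, rfl⟩
      rw [Finset.mem_offDiag]
      exact ⟨hC a (by simp), hC b (by simp), by simpa using this⟩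
  have h4 := Finset.card_le_card h3
  rw [Sym2.card_image_offDiag] at h4
  rw [← Nat.cast_choose_two]
  exact_mod_cast h4

/-- Weak duality. -/
theorem weak_duality {V : Type*} [Fintype V] [DecidableEq V] (E : Finset (Sym2 V))
    (w : Sym2 V → ℝ) (hw : ∀ e ∈ E, 0 ≤ w e) (δ : ℝ) (hδ : 0 ≤ δ)
    (hdeg : ∀ v, ∑ e ∈ E, w e * inc v e ≤ 1)
    (hblo : ∀ C : Finset V, ∑ e ∈ E, w e * ins C e ≤ (1 + δ) * ((C.card / 2 : ℕ) : ℝ))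
    (U : Finset V) (F : Finset (Finset V)) (n : ℕ)
    (hcov : ∀ a b, s(a, b) ∈ E → a ∈ U ∨ b ∈ U ∨ ∃ C ∈ F, a ∈ C ∧ b ∈ C)
    (hn : U.card + ∑ C ∈ F, C.card / 2 ≤ n) :
    ∑ e ∈ E, w e ≤ (1 + δ) * n := by
  have h1 : ∑ e ∈ E, w e ≤ ∑ e ∈ E, (∑ v ∈ U, w e * inc v e + ∑ C ∈ F, w e * ins C e) := by
    refine Finset.sum_le_sum fun e he => ?_
    have hwe := hw e he
    have p1 : ∀ v ∈ U, 0 ≤ w e * inc v e := fun v _ => mul_nonneg hwe (inc_nonneg _ _)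
    have p2 : ∀ C ∈ F, 0 ≤ w e * ins C e := fun v _ => mul_nonneg hwe (ins_nonneg _ _)
    have q1 := Finset.sum_nonneg p1
    have q2 := Finset.sum_nonneg p2
    induction e using Sym2.ind with
    | _ a b =>
      rcases hcov a b he with h | h | ⟨C, hC, ha, hb⟩
      · have := Finset.single_le_sum p1 h
        simp only [inc, Sym2.mem_mk_left, if_true, mul_one] at this
        simp only [inc] at q2 ⊢
        linarith
      · have := Finset.single_le_sum p1 h
        simp only [inc, Sym2.mem_mk_right, if_true, mul_one] at this
        simp only [inc] at q2 ⊢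
        linarith
      · have := Finset.single_le_sum p2 hC
        have e1 : ins C s(a, b) = 1 := by
          simp [ins, ha, hb]
        rw [e1] at this
        linarith
  rw [Finset.sum_add_distrib, Finset.sum_comm, Finset.sum_comm (s := E) (t := F)] at h1
  have h2 : ∑ v ∈ U, ∑ e ∈ E, w e * inc v e ≤ ∑ v ∈ U, (1 : ℝ) :=
    Finset.sum_le_sum fun v _ => hdeg v
  have h3 : ∑ C ∈ F, ∑ e ∈ E, w e * ins C e ≤ ∑ C ∈ F, (1 + δ) * ((C.card / 2 : ℕ) : ℝ) :=
    Finset.sum_le_sum fun C _ => hblo C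
  rw [← Finset.mul_sum] at h3
  simp only [Finset.sum_const, nsmul_eq_mul, mul_one] at h2
  have h4 : (U.card : ℝ) + ∑ C ∈ F, ((C.card / 2 : ℕ) : ℝ) ≤ n := by exact_mod_cast hn
  have h5 : (0 : ℝ) ≤ U.card := by positivity
  nlinarith

theorem degE_cast {V : Type*} [DecidableEq V] (B : Finset (Sym2 V)) (v : V) :
    (degE B v : ℝ) = ∑ e ∈ B, inc v e := by
  unfold degE inc
  rw [Finset.card_filter]; push_cast; rfl

theorem covered_card_le {V : Type*} [Fintype V] [DecidableEq V] (M : Finset (Sym2 V)) :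
    ∑ v, (if Covered M v then (1 : ℝ) else 0) ≤ 2 * M.card := by
  have h : (Finset.univ.filter fun v => Covered M v) ⊆ M.biUnion fun e => e.toFinset := by
    intro v hv
    rw [Finset.mem_filter] at hv
    obtain ⟨_, e, he, hve⟩ := hv
    rw [Finset.mem_biUnion]
    exact ⟨e, he, by simpa using hve⟩
  have h2 := (Finset.card_le_card h).trans
    (Finset.card_biUnion_le_card_mul _ _ 2 fun e _ => by
      rw [Sym2.card_toFinset]; split_ifs <;> omega)
  rw [Finset.card_filter] at h2
  have h3 : ((∑ v, (if Covered M v then 1 else 0) : ℕ) : ℝ) ≤ ((M.card * 2 : ℕ) : ℝ) := by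
    exact_mod_cast h2
  push_cast at h3
  linarith

theorem core {V : Type*} [Fintype V] [DecidableEq V] (M B A : Finset (Sym2 V)) (k K : ℕ)
    (β γ t ε r : ℝ) (hγ : 0 < γ) (hβ : 0 < β) (hβγ : β = 1 - 2 * γ) (hβγ2 : β * (1 - γ) = γ)
    (ht : 0 < t) (htε : t ≤ ε ^ 3) (htK : t * K = 1) (htk : t * k ≤ β)
    (hr1 : r ≤ 1) (hr : γ * r ≤ (1 - γ) * (t * k)) (hε0 : 0 < ε) (hε1 : ε < 1)
    (hMd : ∀ e ∈ M, ¬ e.IsDiag) (hBd : ∀ e ∈ B, ¬ e.IsDiag) (hAd : ∀ e ∈ A, ¬ e.IsDiag)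
    (hM : ∀ e ∈ M, ∀ f ∈ M, e ≠ f → ∀ v : V, v ∈ e → v ∉ f)
    (hA : ∀ e ∈ A, ∀ f ∈ A, e ≠ f → ∀ v : V, v ∈ e → v ∉ f)
    (hAM : ∀ e ∈ A, ∃ v ∈ e, Covered M v)
    (hB1 : ∀ e ∈ B, (∃ v ∈ e, Covered M v) ∧ (∃ v ∈ e, ¬ Covered M v))
    (hB2 : ∀ u, Covered M u → degE B u ≤ k)
    (hB3 : ∀ u, ¬ Covered M u → degE B u ≤ K)
    (hB4 : ∀ e ∈ A, (∃ v ∈ e, Covered M v) → (∃ v ∈ e, ¬ Covered M v) → e ∉ B →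
      (∃ u ∈ e, Covered M u ∧ k ≤ degE B u) ∨ (∃ u ∈ e, ¬ Covered M u ∧ K ≤ degE B u))
    (U : Finset V) (F : Finset (Finset V)) (n : ℕ)
    (hcov : ∀ a b, s(a, b) ∈ M ∪ B → a ∈ U ∨ b ∈ U ∨ ∃ C ∈ F, a ∈ C ∧ b ∈ C)
    (hn : U.card + ∑ C ∈ F, C.card / 2 ≤ n) :
    r * (2 * γ) * A.card ≤ (1 + 2 * ε) * n := by
  have hγ1 : γ < 1 := by linarith
  have hβ1 : β ≤ 1 := by linarith
  -- slack at vertices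
  let g : V → ℝ := fun v => if Covered M v then β - t * degE B v else 1 - t * degE B v
  have hgc : ∀ v, Covered M v → g v = β - t * degE B v := fun v h => by simp [g, h]
  have hgu : ∀ v, ¬ Covered M v → g v = 1 - t * degE B v := fun v h => by simp [g, h]
  have hdk : ∀ v, Covered M v → t * degE B v ≤ t * k := fun v h =>
    mul_le_mul_of_nonneg_left (by exact_mod_cast hB2 v h) ht.le
  have hdK : ∀ v, ¬ Covered M v → t * degE B v ≤ 1 := fun v h => by
    rw [← htK]; exact mul_le_mul_of_nonneg_left (by exact_mod_cast hB3 v h) ht.le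
  have htd : ∀ v, 0 ≤ t * degE B v := fun v => by positivity
  have hg0 : ∀ v, 0 ≤ g v := by
    intro v
    by_cases h : Covered M v
    · rw [hgc v h]; linarith [hdk v h]
    · rw [hgu v h]; linarith [hdK v h]
  let ext : Sym2 V → ℝ := Sym2.lift ⟨fun a b => min (g a) (g b), fun a b => min_comm _ _⟩
  have hext : ∀ a b, ext s(a, b) = min (g a) (g b) := fun a b => rfl
  have hext0 : ∀ e, 0 ≤ ext e := by
    intro e
    induction e using Sym2.ind with
    | _ a b => rw [hext]; exact le_min (hg0 a) (hg0 b)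
  have hextg : ∀ e, ∀ v ∈ e, ext e ≤ g v := by
    intro e v hv
    obtain ⟨b, rfl⟩ := hv
    rw [hext]; exact min_le_left _ _
  have hextβ : ∀ e ∈ B, ext e ≤ β := by
    intro e he
    obtain ⟨⟨v, hv, hc⟩, _⟩ := hB1 e he
    have := hextg e v hv
    rw [hgc v hc] at this
    linarith [htd v]
  let w : Sym2 V → ℝ := fun e => (if e ∈ M then 2 * γ else 0) + (if e ∈ B then t else 0) +
    (if e ∈ A ∩ B then ext e else 0)
  have hw0 : ∀ e ∈ M ∪ B, 0 ≤ w e := by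
    intro e _
    have := hext0 e
    simp only [w]
    split_ifs <;> linarith
  have hsum : ∀ p : Sym2 V → ℝ, ∑ e ∈ M ∪ B, w e * p e =
      2 * γ * ∑ e ∈ M, p e + t * ∑ e ∈ B, p e + ∑ e ∈ A ∩ B, ext e * p e := by
    intro p
    simp only [w, add_mul, Finset.sum_add_distrib, ite_mul, zero_mul, Finset.sum_ite_mem,
      Finset.mul_sum]
    congr 1
    · congr 1
      · rw [Finset.inter_eq_right.2 Finset.subset_union_left]
      · rw [Finset.inter_eq_right.2 Finset.subset_union_right]
    · rw [Finset.inter_eq_right.2]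
      exact Finset.inter_subset_right.trans Finset.subset_union_right
  have hAB : ∀ e ∈ A ∩ B, ∀ f ∈ A ∩ B, e ≠ f → ∀ v : V, v ∈ e → v ∉ f := fun e he f hf =>
    hA e (Finset.mem_inter.1 he).1 f (Finset.mem_inter.1 hf).1
  have hdeg : ∀ v, ∑ e ∈ M ∪ B, w e * inc v e ≤ 1 := by
    intro v
    rw [hsum, ← degE_cast B v]
    have h1 := matching_at_le (A ∩ B) hAB ext v (g v) (hg0 v) fun e _ hv => hextg e v hv
    by_cases h : Covered M v
    · have h2 := matching_at_le M hM (fun _ => 1) v 1 zero_le_one fun _ _ _ => le_rfl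
      simp only [one_mul] at h2
      rw [hgc v h] at h1
      nlinarith
    · have h2 : ∑ e ∈ M, inc v e = 0 := by
        refine Finset.sum_eq_zero fun e he => ?_
        unfold inc
        rw [if_neg]
        exact fun hv => h ⟨e, he, hv⟩
      rw [hgu v h] at h1
      rw [h2]
      linarith
  have hEd : ∀ e ∈ M ∪ B, ¬ e.IsDiag := by
    intro e he
    rcases Finset.mem_union.1 he with h | h
    · exact hMd e h
    · exact hBd e h
  have hblo : ∀ C : Finset V,
      ∑ e ∈ M ∪ B, w e * ins C e ≤ (1 + 2 * ε) * ((C.card / 2 : ℕ) : ℝ) := by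
    intro C
    have hhalf := half_bound (M ∪ B) hEd w hw0 hdeg C
    obtain ⟨j, hj⟩ : ∃ j, j = C.card / 2 := ⟨_, rfl⟩
    have hM1 := matching_in_card M hMd hM C
    have hA1 := matching_in_card (A ∩ B) (fun e he => hBd e (Finset.mem_inter.1 he).2) hAB C
    have hBC := edges_in_card B hBd C
    rw [← hj] at hM1 hA1 ⊢
    have hj0 : (0 : ℝ) ≤ j := by positivity
    rcases Nat.even_or_odd' C.card with ⟨i, hi | hi⟩
    · have : i = j := by omega
      rw [hi, this] at hhalf
      push_cast at hhalf
      nlinarith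
    · have hij : i = j := by omega
      rw [hi, hij] at hhalf hBC
      push_cast at hhalf hBC
      by_cases hbig : 1 ≤ 4 * ε * j
      · nlinarith
      · push Not at hbig
        rw [hsum]
        have h3 : ∑ e ∈ A ∩ B, ext e * ins C e ≤ β * j := by
          calc ∑ e ∈ A ∩ B, ext e * ins C e ≤ ∑ e ∈ A ∩ B, β * ins C e :=
                Finset.sum_le_sum fun e he => mul_le_mul_of_nonneg_right
                  (hextβ e (Finset.mem_inter.1 he).2) (ins_nonneg _ _)
            _ = β * ∑ e ∈ A ∩ B, ins C e := by rw [Finset.mul_sum]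
            _ ≤ β * j := mul_le_mul_of_nonneg_left hA1 hβ.le
        have h4 : t * ∑ e ∈ B, ins C e ≤ 2 * ε * j := by
          have a1 : t * ∑ e ∈ B, ins C e ≤ t * (j * (2 * j + 1)) := by
            refine mul_le_mul_of_nonneg_left ?_ ht.le
            linarith
          have a2 : t * (2 * j + 1) ≤ 2 * ε := by
            have b1 : t * (2 * j + 1) ≤ ε ^ 3 * (2 * j + 1) :=
              mul_le_mul_of_nonneg_right htε (by positivity)
            have b2 : ε ^ 3 * (2 * j + 1) = ε ^ 2 * (2 * (ε * j)) + ε ^ 3 := by ring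
            have b3 : ε * j ≤ 1 / 4 := by linarith
            have b4 : ε ^ 2 ≤ ε := by nlinarith
            have b5 : ε ^ 3 ≤ ε := by nlinarith
            have b6 : ε ^ 2 * (2 * (ε * j)) ≤ ε ^ 2 * (1 / 2) :=
              mul_le_mul_of_nonneg_left (by linarith) (by positivity)
            linarith
          have a3 := mul_le_mul_of_nonneg_right a2 hj0
          linarith
        have h5 : 2 * γ * ∑ e ∈ M, ins C e ≤ 2 * γ * j :=
          mul_le_mul_of_nonneg_left hM1 (by linarith)
        have h6 : 2 * γ * j + β * j = j := by rw [hβγ]; ring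
        linarith
  have hdual := weak_duality (M ∪ B) w hw0 (2 * ε) (by linarith) hdeg hblo U F n hcov hn
  refine le_trans ?_ hdual
  have htot := hsum (fun _ => 1)
  simp only [mul_one, Finset.sum_const, nsmul_eq_mul] at htot
  rw [htot]
  -- the lower bound
  let c : V → ℝ := fun v => if Covered M v then 1 - γ else γ
  let ψ : V → ℝ := fun v => c v * (t * degE B v) + γ * (if Covered M v then 1 else 0)
  have hc0 : ∀ v, 0 ≤ c v := by intro v; simp only [c]; split_ifs <;> linarith
  have hψ0 : ∀ v, 0 ≤ ψ v := by
    intro v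
    have := mul_nonneg (hc0 v) (htd v)
    simp only [ψ]; split_ifs <;> linarith
  have hψ : ∑ v, ψ v ≤ 2 * γ * M.card + t * B.card := by
    simp only [ψ, Finset.sum_add_distrib]
    rw [← Finset.mul_sum (f := fun v => if Covered M v then (1 : ℝ) else 0)]
    have h1 := mul_le_mul_of_nonneg_left (covered_card_le M) hγ.le
    have h2 : ∑ v, c v * (t * degE B v) = t * B.card := by
      simp_rw [degE_cast, Finset.mul_sum]
      rw [Finset.sum_comm]
      have : ∀ e ∈ B, ∑ v, c v * (t * inc v e) = t := by
        intro e he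
        have hd := hBd e he
        obtain ⟨⟨u, hu, hcu⟩, ⟨v, hv, hcv⟩⟩ := hB1 e he
        have huv : u ≠ v := fun h => hcv (h ▸ hcu)
        have he' : e = s(u, v) := (Sym2.mem_and_mem_iff huv).1 ⟨hu, hv⟩
        have h3 := inc_sum (fun v => c v * t) huv
        rw [← he'] at h3
        simp only [mul_assoc] at h3
        rw [h3]
        simp only [c, hcu, hcv, if_true, if_false]
        ring
      rw [Finset.sum_congr rfl this]
      simp [mul_comm]
    linarith
  have hlow := matching_sum_le A hA ψ hψ0
  have hext2 : ∑ e ∈ A ∩ B, ext e = ∑ e ∈ A, if e ∈ B then ext e else 0 := by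
    rw [Finset.sum_ite_mem]
  have hmain : ∑ e ∈ A, r * (2 * γ) ≤
      ∑ e ∈ A, ((∑ v, ψ v * inc v e) + if e ∈ B then ext e else 0) := by
    refine Finset.sum_le_sum fun e he => ?_
    obtain ⟨u, hu, hcu⟩ := hAM e he
    obtain ⟨v, rfl⟩ := hu
    have huv : u ≠ v := by simpa using hAd _ he
    rw [inc_sum ψ huv]
    have hψu : ψ u = (1 - γ) * (t * degE B u) + γ := by simp [ψ, c, hcu]
    have hrγ : r * γ ≤ γ := by nlinarith
    have hu0 := htd u
    have hv0 := htd v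
    have hx0 : 0 ≤ (if s(u, v) ∈ B then ext s(u, v) else 0) := by
      split_ifs
      · exact hext0 _
      · exact le_rfl
    have p1 : 0 ≤ (1 - γ) * (t * degE B u) := mul_nonneg (by linarith) hu0
    by_cases hcv : Covered M v
    · have hψv : ψ v = (1 - γ) * (t * degE B v) + γ := by simp [ψ, c, hcv]
      have p2 : 0 ≤ (1 - γ) * (t * degE B v) := mul_nonneg (by linarith) hv0
      rw [hψu, hψv]
      linarith
    · have hψv : ψ v = γ * (t * degE B v) := by simp [ψ, c, hcv]
      have p2 : 0 ≤ γ * (t * degE B v) := mul_nonneg hγ.le hv0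
      rw [hψu, hψv]
      by_cases hBe : s(u, v) ∈ B
      · rw [if_pos hBe, hext, hgc u hcu, hgu v hcv]
        have q1 := hdk u hcu
        have q2 := hdK v hcv
        rcases min_choice (β - t * degE B u) (1 - t * degE B v) with hm | hm
        · rw [hm]
          have : γ * (t * degE B u) ≤ γ * β := mul_le_mul_of_nonneg_left (by linarith) hγ.le
          linarith
        · rw [hm]
          have : (1 - γ) * (t * degE B v) ≤ (1 - γ) * 1 :=
            mul_le_mul_of_nonneg_left q2 (by linarith)
          linarith
      · rw [if_neg hBe]
        rcases hB4 _ he ⟨u, by simp, hcu⟩ ⟨v, by simp, hcv⟩ hBe with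
          ⟨x, hx, hx1, hx2⟩ | ⟨x, hx, hx1, hx2⟩
        · have hxu : x = u := by
            rcases Sym2.mem_iff.1 hx with h | h
            · exact h
            · exact absurd (h ▸ hx1) hcv
          subst hxu
          have : (1 - γ) * (t * k) ≤ (1 - γ) * (t * degE B x) := by
            refine mul_le_mul_of_nonneg_left ?_ (by linarith)
            exact mul_le_mul_of_nonneg_left (by exact_mod_cast hx2) ht.le
          linarith
        · have hxv : x = v := by
            rcases Sym2.mem_iff.1 hx with h | h
            · exact absurd hcu (h ▸ hx1)
            · exact h
          subst hxv
          have h7 : t * K ≤ t * degE B x :=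
            mul_le_mul_of_nonneg_left (by exact_mod_cast hx2) ht.le
          have : γ * 1 ≤ γ * (t * degE B x) :=
            mul_le_mul_of_nonneg_left (by linarith) hγ.le
          linarith
  rw [Finset.sum_add_distrib, ← hext2] at hmain
  simp only [Finset.sum_const, nsmul_eq_mul] at hmain
  linarith

/-- The two-pass algorithm: let `0 < ε < 1`, `b = 1+√2`, `k ≥ 1/(bε³)` an integer, and let
`e₁,…,e_m` be any ordering of the edges of `G`. Let `M` be the greedy maximal matching of
this ordering, and let `B` be the greedy `b`-matching on `H = G[V(M), V∖V(M)]` with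
capacities `k` on `V(M)` and `⌈kb⌉` on `V∖V(M)`, processing edges in the same order.
Then `M ∪ B` contains a matching of size at least `(1−ε)³·(2−√2)·μ(G)`. -/
theorem stmt12 {V : Type*} [Fintype V] [DecidableEq V]
    (ε b : ℝ) (hε0 : 0 < ε) (hε1 : ε < 1) (hb : b = 1 + Real.sqrt 2)
    (k : ℕ) (hk : (k : ℝ) ≥ 1 / (b * ε ^ 3))
    (G : SimpleGraph V) (l : List (Sym2 V)) (hnd : l.Nodup)
    (hl : ∀ e : Sym2 V, e ∈ l ↔ e ∈ G.edgeSet) :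
    ∃ N : Finset (Sym2 V),
      N ⊆ greedyMatching l ∪ greedyB (greedyMatching l) k ⌈(k : ℝ) * b⌉₊ l ∧
      IsMatching G N ∧
      ∀ N' : Finset (Sym2 V), IsMatching G N' →
        (N.card : ℝ) ≥ (1 - ε) ^ 3 * (2 - Real.sqrt 2) * N'.card := by
  have hs2 : Real.sqrt 2 ^ 2 = 2 := Real.sq_sqrt (by norm_num)
  have hs0 : 0 < Real.sqrt 2 := by positivity
  have hs1 : 1 < Real.sqrt 2 := by nlinarith
  have hs3 : Real.sqrt 2 < 2 := by nlinarith
  set q := Real.sqrt 2 with hq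
  have hb0 : 0 < b := by rw [hb]; linarith
  have hε3 : 0 < ε ^ 3 := by positivity
  have hbk : 1 ≤ (k : ℝ) * b * ε ^ 3 := by
    have h1 : 1 / (b * ε ^ 3) ≤ k := hk
    rw [div_le_iff₀ (by positivity)] at h1
    linarith
  have hk0 : 0 < (k : ℝ) * b := by
    by_contra h
    push Not at h
    nlinarith
  set K := ⌈(k : ℝ) * b⌉₊ with hK
  have hK1 : (k : ℝ) * b ≤ K := Nat.le_ceil _
  have hK2 : (K : ℝ) < k * b + 1 := Nat.ceil_lt_add_one hk0.le
  have hK0 : 0 < (K : ℝ) := by linarith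
  obtain ⟨m1, m2, m3⟩ := gm_spec l
  set M := greedyMatching l with hMdef
  obtain ⟨b1, b2, b3, b4⟩ := gb_spec M k K l
  set B := greedyB M k K l with hBdef
  have hGd : ∀ e ∈ G.edgeSet, ¬ e.IsDiag := fun e he => G.not_isDiag_of_mem_edgeSet he
  have hMG : ∀ e ∈ M, e ∈ G.edgeSet := fun e he => (hl e).1 (m1 e he)
  have hBG : ∀ e ∈ B, e ∈ G.edgeSet := fun e he => (hl e).1 (b1 e he).1
  have hEG : ∀ e ∈ M ∪ B, e ∈ G.edgeSet := by
    intro e he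
    rcases Finset.mem_union.1 he with h | h
    · exact hMG e h
    · exact hBG e h
  obtain ⟨N, hN, U, F, hUF, hn⟩ := tutteBerge (SimpleGraph.fromEdgeSet ((M ∪ B : Finset _) : Set (Sym2 V)))
  have hNE : N ⊆ M ∪ B := by
    intro e he
    have := hN.1 e he
    rw [SimpleGraph.edgeSet_fromEdgeSet] at this
    exact_mod_cast this.1
  refine ⟨N, hNE, ⟨fun e he => hEG e (hNE he), hN.2⟩, ?_⟩
  intro A hA
  have hcov : ∀ a b, s(a, b) ∈ M ∪ B → a ∈ U ∨ b ∈ U ∨ ∃ C ∈ F, a ∈ C ∧ b ∈ C := by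
    intro a b hab
    refine hUF a b ?_
    rw [SimpleGraph.fromEdgeSet_adj]
    exact ⟨by exact_mod_cast hab, by simpa using hGd _ (hEG _ hab)⟩
  have hkK : (k : ℝ) * b * (1 + ε ^ 3) ≥ K := by nlinarith
  have key := core M B A k K (q - 1) ((2 - q) / 2) (1 / K) ε (1 / (1 + ε ^ 3))
    (by linarith) (by linarith) (by ring) (by nlinarith) (by positivity)
    (by
      rw [div_le_iff₀ hK0]
      nlinarith)
    (by field_simp)
    (by
      rw [one_div, ← div_eq_inv_mul, div_le_iff₀ hK0]
      have h1 : (q - 1) * (k * b) = k := by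
        rw [hb]
        have : (q - 1) * (k * (1 + q)) = k * (q ^ 2 - 1) := by ring
        rw [this, hs2]; ring
      have h2 := mul_le_mul_of_nonneg_left hK1 (by linarith : 0 ≤ q - 1)
      linarith)
    (by
      rw [div_le_one (by positivity)]; linarith)
    (by
      have h1 : 1 - (2 - q) / 2 = (2 - q) / 2 * b := by
        rw [hb]
        nlinarith
      rw [h1]
      have h2 : 1 / (1 + ε ^ 3) ≤ b * (1 / K * k) := by
        rw [div_le_iff₀ (by positivity)]
        have : b * (1 / K * k) * (1 + ε ^ 3) = (k * b * (1 + ε ^ 3)) / K := by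
          field_simp
        rw [this, le_div_iff₀ hK0]
        linarith
      have h3 := mul_le_mul_of_nonneg_left h2 (by linarith : 0 ≤ (2 - q) / 2)
      linarith)
    hε0 hε1 (fun e he => hGd e (hMG e he)) (fun e he => hGd e (hBG e he))
    (fun e he => hGd e (hA.1 e he)) m2 hA.2 (fun e he => m3 e ((hl e).2 (hA.1 e he)))
    (fun e he => (b1 e he).2) b2 b3 (fun e he => b4 e ((hl e).2 (hA.1 e he)))
    U F N.card hcov hn
  have h2q : 2 * ((2 - q) / 2) = 2 - q := by ring
  rw [h2q] at key
  have hA0 : (0 : ℝ) ≤ A.card := by positivity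
  have hX : 0 ≤ (2 - q) * A.card := mul_nonneg (by linarith) hA0
  have hε3' : ε ^ 3 ≤ ε := by
    have : ε ^ 2 ≤ 1 := by nlinarith
    nlinarith
  have hpoly : (1 - ε) ^ 3 * (1 + ε ^ 3) * (1 + 2 * ε) ≤ 1 := by
    have p1 : (1 - ε) * (1 + ε ^ 3) ≤ 1 := by nlinarith
    have p2 : (1 - ε) ^ 2 * (1 + 2 * ε) ≤ 1 := by nlinarith [sq_nonneg ε]
    have p3 : 0 ≤ (1 - ε) * (1 + ε ^ 3) := mul_nonneg (by linarith) (by linarith)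
    have p4 : 0 ≤ (1 - ε) ^ 2 * (1 + 2 * ε) := mul_nonneg (by positivity) (by linarith)
    calc (1 - ε) ^ 3 * (1 + ε ^ 3) * (1 + 2 * ε)
        = ((1 - ε) * (1 + ε ^ 3)) * ((1 - ε) ^ 2 * (1 + 2 * ε)) := by ring
      _ ≤ 1 := mul_le_one₀ p1 p4 p2
  have key2 : (2 - q) * A.card ≤ (1 + ε ^ 3) * ((1 + 2 * ε) * N.card) := by
    have h := mul_le_mul_of_nonneg_left key (by positivity : 0 ≤ 1 + ε ^ 3)
    have h' : (1 + ε ^ 3) * (1 / (1 + ε ^ 3) * (2 - q) * A.card) = (2 - q) * A.card := by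
      field_simp
    linarith
  have h1ε : 0 ≤ (1 - ε) ^ 3 := by
    have : 0 < 1 - ε := by linarith
    positivity
  have hN0 : (0 : ℝ) ≤ N.card := by positivity
  calc (1 - ε) ^ 3 * (2 - q) * A.card = (1 - ε) ^ 3 * ((2 - q) * A.card) := by ring
    _ ≤ (1 - ε) ^ 3 * ((1 + ε ^ 3) * ((1 + 2 * ε) * N.card)) :=
      mul_le_mul_of_nonneg_left key2 h1ε
    _ = (1 - ε) ^ 3 * (1 + ε ^ 3) * (1 + 2 * ε) * N.card := by ring
    _ ≤ 1 * N.card := mul_le_mul_of_nonneg_right hpoly hN0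
    _ = N.card := one_mul _
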